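/- If |Z| ≤ 1 − ε almost surely for some 0 < ε < 1, then for every k ≥ 1 and every q ∈ [0,1], the recursively defined coefficient processes satisfy |Σ_k(Z; q)| ≤ (1−ε)^k / k almost surely. -/

import Mathlib

open MeasureTheory

/-- The array `Λ_{k,n}(a)` defined by `Λ_{n,n}(a) = a_1^n`, `Λ_{k,1}(a) = a_k`, and
`Λ_{k,n}(a) = Σ_{m=n-1}^{k-1} a_{k-m} Λ_{m,n-1}(a)` for `2 ≤ n < k`
(all operations taken pointwise when `a` consists of functions). -/
def Lam (a : ℕ → ℝ) : ℕ → ℕ → ℝ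
  | _, 0 => 0
  | k, 1 => a k
  | k, n + 2 => ∑ m ∈ Finset.Ico (n + 1) k, a (k - m) * Lam a m (n + 1)

open scoped PowerSeries

theorem abs_Lam_le {a c : ℕ → ℝ} (n : ℕ) : ∀ k, 1 ≤ k →
    (∀ j, 1 ≤ j → j + n ≤ k → |a j| ≤ c j) → |Lam a k (n + 1)| ≤ Lam c k (n + 1) := by
  induction n with
  | zero => intro k hk h; simpa [Lam] using h k hk (by simp)
  | succ n ih =>
    intro k hk h
    simp only [Lam]
    refine (Finset.abs_sum_le_sum_abs _ _).trans (Finset.sum_le_sum fun m hm => ?_)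
    rw [Finset.mem_Ico] at hm
    rw [abs_mul]
    have h1 := h (k - m) (by omega) (by omega)
    have h2 := ih m (by omega) fun j hj hjm => h j hj (by omega)
    exact mul_le_mul h1 h2 (abs_nonneg _) ((abs_nonneg _).trans h1)

theorem coeff_pow_eq_zero_of_lt {F : ℝ⟦X⟧} (hF : PowerSeries.constantCoeff F = 0) {k n : ℕ}
    (h : k < n) : PowerSeries.coeff k (F ^ n) = 0 :=
  PowerSeries.X_pow_dvd_iff.1 (pow_dvd_pow_of_dvd (PowerSeries.X_dvd_iff.2 hF) n) k h

theorem Lam_eq_coeff {a : ℕ → ℝ} (ha : a 0 = 0) (n : ℕ) : ∀ k,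
    Lam a k (n + 1) = PowerSeries.coeff k (PowerSeries.mk a ^ (n + 1)) := by
  induction n with
  | zero => intro k; simp [Lam]
  | succ n ih =>
    intro k
    have hF : PowerSeries.constantCoeff (PowerSeries.mk a) = 0 := by
      rw [← PowerSeries.coeff_zero_eq_constantCoeff_apply, PowerSeries.coeff_mk, ha]
    rw [pow_succ, PowerSeries.coeff_mul, Finset.Nat.sum_antidiagonal_eq_sum_range_succ_mk]
    simp only [Lam, PowerSeries.coeff_mk]
    refine Finset.sum_subset_zero_on_sdiff (fun m hm => ?_) (fun m hm => ?_) (fun m hm => ?_)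
    · simp only [Finset.mem_Ico, Finset.mem_range] at hm ⊢; omega
    · simp only [Finset.mem_Ico, Finset.mem_range, Finset.mem_sdiff, not_and, not_lt] at hm
      rcases lt_or_ge m (n + 1) with h | h
      · rw [coeff_pow_eq_zero_of_lt hF h, zero_mul]
      · have : k - m = 0 := by omega
        rw [this, ha, mul_zero]
    · rw [ih, mul_comm]

theorem Lam_geometric_mul {a : ℕ → ℝ} (ha : a 0 = 0) (r : ℝ) (n k : ℕ) :
    Lam (fun j => r ^ j * a j) k (n + 1) = r ^ k * Lam a k (n + 1) := by
  have : PowerSeries.mk (fun j => r ^ j * a j) = PowerSeries.rescale r (PowerSeries.mk a) := by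
    ext; simp [PowerSeries.coeff_rescale]
  rw [Lam_eq_coeff (by simp [ha]), Lam_eq_coeff ha, this, ← map_pow, PowerSeries.coeff_rescale]

/-- The polynomials `(1 - t)(2 - t) ⋯ (k - 1 - t) / k!` for `k ≥ 1`, and `0` for `k = 0`. They are
the coefficients of the power series `(1 - (1 - z) ^ t) / t` in `z`. -/
noncomputable def binomCoeff : ℕ → Polynomial ℝ
  | 0 => 0
  | 1 => 1
  | k + 2 => Polynomial.C ((k + 2 : ℝ)⁻¹) *
      (Polynomial.C (k + 1 : ℝ) - Polynomial.X) * binomCoeff (k + 1)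

theorem eval_binomCoeff_add_two (k : ℕ) (t : ℝ) :
    (k + 2 : ℝ) * (binomCoeff (k + 2)).eval t = (k + 1 - t) * (binomCoeff (k + 1)).eval t := by
  have : (k + 2 : ℝ) ≠ 0 := by positivity
  simp only [binomCoeff, Polynomial.eval_mul, Polynomial.eval_sub, Polynomial.eval_C,
    Polynomial.eval_X]
  field_simp

theorem eval_derivative_binomCoeff_add_two (k : ℕ) (t : ℝ) :
    (k + 2 : ℝ) * (binomCoeff (k + 2)).derivative.eval t =
      (k + 1 - t) * (binomCoeff (k + 1)).derivative.eval t - (binomCoeff (k + 1)).eval t := by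
  have : (k + 2 : ℝ) ≠ 0 := by positivity
  simp only [binomCoeff, Polynomial.eval_mul, Polynomial.eval_sub, Polynomial.eval_C,
    Polynomial.eval_X, Polynomial.derivative_mul, Polynomial.derivative_C, Polynomial.eval_add,
    Polynomial.derivative_sub, Polynomial.derivative_X, Polynomial.eval_zero, Polynomial.eval_one]
  field_simp
  ring

theorem eval_binomCoeff_mem_Icc (k : ℕ) {t : ℝ} (ht : t ∈ Set.Icc (0 : ℝ) 1) :
    (binomCoeff (k + 1)).eval t ∈ Set.Icc (0 : ℝ) (1 / (k + 1)) := by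
  induction k with
  | zero => simp [binomCoeff]
  | succ k ih =>
    have h2 : (0 : ℝ) < k + 2 := by positivity
    have h1 : (0 : ℝ) < k + 1 := by positivity
    have hrec := eval_binomCoeff_add_two k t
    have hle := (le_div_iff₀ h1).1 ih.2
    have hk : (0 : ℝ) ≤ k := by positivity
    push_cast
    constructor
    · refine nonneg_of_mul_nonneg_right ?_ h2
      rw [hrec]
      exact mul_nonneg (by linarith [ht.2]) ih.1
    · rw [show (k : ℝ) + 1 + 1 = k + 2 by ring, le_div_iff₀ h2]
      nlinarith [ht.1, ih.1]

theorem eval_one_binomCoeff_add_two (k : ℕ) : (binomCoeff (k + 2)).eval 1 = 0 := by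
  induction k with
  | zero => simp [binomCoeff]
  | succ k ih =>
    rw [binomCoeff, Polynomial.eval_mul, ih, mul_zero]

section GeneratingSeries

open PowerSeries

/-- A linear first-order differential equation for power series has at most one solution with a
given constant coefficient. -/
theorem PowerSeries.eq_zero_of_one_sub_X_mul_derivative {G : ℝ⟦X⟧} (t : ℝ)
    (h0 : constantCoeff G = 0) (h : (1 - X) * d⁄dX ℝ G = -(C t * G)) : G = 0 := by
  ext k
  induction k with
  | zero => simpa using h0
  | succ k ih =>
    have := congrArg (coeff k) h
    rw [sub_mul, one_mul, map_sub, coeff_derivative] at this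
    simp only [map_zero, map_neg, coeff_C_mul] at this ih ⊢
    rw [ih] at this
    have hX : coeff k (X * d⁄dX ℝ G) = 0 := by
      cases k with
      | zero => simp
      | succ k => rw [coeff_succ_X_mul, coeff_derivative, ih, zero_mul]
    rw [hX] at this
    have hk : (k + 1 : ℝ) ≠ 0 := by positivity
    simpa [hk] using this

/-- The formal sum `∑ n, c n • F ^ n` exists when `F` has no constant term; its coefficients are
those of any sufficiently long partial sum. -/
theorem exists_powerSeries_sum {F : ℝ⟦X⟧} (hF : constantCoeff F = 0) (c : ℕ → ℝ) :
    ∃ V : ℝ⟦X⟧, constantCoeff V = c 0 ∧ ∀ k N, k ≤ N →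
      coeff k V = coeff k (∑ n ∈ Finset.range (N + 1), c n • F ^ n) := by
  refine ⟨mk fun k => ∑ n ∈ Finset.range (k + 1), c n * coeff k (F ^ n), ?_, fun k N h => ?_⟩
  · rw [← coeff_zero_eq_constantCoeff_apply, coeff_mk]; simp
  · simp only [coeff_mk, map_sum, map_smul, smul_eq_mul]
    refine Finset.sum_subset (Finset.range_mono (by omega)) fun n _ hn => ?_
    rw [coeff_pow_eq_zero_of_lt hF (by simpa using hn), mul_zero]

/-- Termwise differentiation of the formal sum `∑ n, c n • F ^ n`. -/
theorem derivative_eq_mul_of_coeff {F V U : ℝ⟦X⟧} {c d : ℕ → ℝ}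
    (hV : ∀ k N, k ≤ N → coeff k V = coeff k (∑ n ∈ Finset.range (N + 1), c n • F ^ n))
    (hU : ∀ k N, k ≤ N → coeff k U = coeff k (∑ n ∈ Finset.range (N + 1), d n • F ^ n))
    (hcd : ∀ n, (n + 1) * c (n + 1) = d n) : d⁄dX ℝ V = d⁄dX ℝ F * U := by
  ext k
  have h1 : coeff k (d⁄dX ℝ F * U) =
      coeff k (d⁄dX ℝ F * ∑ n ∈ Finset.range (k + 1), d n • F ^ n) := by
    rw [coeff_mul, coeff_mul]
    refine Finset.sum_congr rfl fun p hp => ?_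
    rw [hU p.2 k (by
      have := Finset.HasAntidiagonal.mem_antidiagonal.1 hp
      omega)]
  rw [h1, coeff_derivative, hV (k + 1) (k + 1) le_rfl, ← coeff_derivative]
  congr 1
  rw [Finset.sum_range_succ', map_add, map_sum, Finset.mul_sum]
  simp only [pow_zero, Derivation.map_smul, Derivation.map_one_eq_zero, smul_zero, add_zero]
  refine Finset.sum_congr rfl fun n _ => ?_
  rw [Derivation.leibniz_pow, ← hcd]
  simp only [smul_eq_C_mul, nsmul_eq_mul, smul_eq_mul, map_mul, add_tsub_cancel_right]
  have : ((n + 1 : ℕ) : ℝ⟦X⟧) = C ((n : ℝ) + 1) := by simp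
  rw [this]
  ring

/-- The formal geometric series `∑ n, t ^ n • F ^ n` is the inverse of `1 - t F`. -/
theorem one_sub_C_mul_mul_eq_one {F U : ℝ⟦X⟧} (hF : constantCoeff F = 0) (t : ℝ)
    (hU : ∀ k N, k ≤ N → coeff k U = coeff k (∑ n ∈ Finset.range (N + 1), t ^ n • F ^ n)) :
    (1 - C t * F) * U = 1 := by
  ext k
  have h1 : coeff k ((1 - C t * F) * U) =
      coeff k ((1 - C t * F) * ∑ n ∈ Finset.range (k + 1), (C t * F) ^ n) := by
    rw [coeff_mul, coeff_mul]
    refine Finset.sum_congr rfl fun p hp => ?_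
    rw [hU p.2 k (by
      have := Finset.HasAntidiagonal.mem_antidiagonal.1 hp
      omega)]
    simp only [mul_pow, smul_eq_C_mul, map_pow]
  rw [h1, mul_neg_geom_sum, map_sub, mul_pow, ← map_pow, coeff_C_mul,
    coeff_pow_eq_zero_of_lt hF (by omega), mul_zero, sub_zero]

/-- With `F = (1 - (1 - z) ^ t) / t`, this is the coefficient of `z ^ k` in
`∑ n ≥ 2, t ^ (n - 2) F ^ n / (n (n - 1)) = -∂F/∂t`. -/
theorem sum_Lam_binomCoeff (t : ℝ) (k : ℕ) :
    ∑ n ∈ Finset.Icc 2 k, t ^ (n - 2) / ((n : ℝ) * ((n : ℝ) - 1)) *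
      Lam (fun j => (binomCoeff j).eval t) k n = -(binomCoeff k).derivative.eval t := by
  set F : ℝ⟦X⟧ := mk fun j => (binomCoeff j).eval t with hFdef
  set D : ℝ⟦X⟧ := mk fun j => -(binomCoeff j).derivative.eval t with hDdef
  have hF0 : constantCoeff F = 0 := by
    rw [← coeff_zero_eq_constantCoeff_apply, coeff_mk]; simp [binomCoeff]
  have hD0 : constantCoeff D = 0 := by
    rw [← coeff_zero_eq_constantCoeff_apply, coeff_mk]; simp [binomCoeff]
  obtain ⟨U, -, hU⟩ := exists_powerSeries_sum hF0 fun n => t ^ n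
  obtain ⟨V, hV0, hV⟩ := exists_powerSeries_sum hF0 fun n => t ^ (n - 1) / n
  obtain ⟨W, hW0, hW⟩ := exists_powerSeries_sum hF0
    fun n => t ^ (n - 2) / ((n : ℝ) * ((n : ℝ) - 1))
  have hV0 : constantCoeff V = 0 := by simpa using hV0
  have hW0 : constantCoeff W = 0 := by simpa using hW0
  have hdV : d⁄dX ℝ V = d⁄dX ℝ F * U := derivative_eq_mul_of_coeff hV hU fun n => by
    push_cast
    have : (n + 1 : ℝ) ≠ 0 := by positivity
    field_simp
  have hdW : d⁄dX ℝ W = d⁄dX ℝ F * V := derivative_eq_mul_of_coeff hW hV fun n => by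
    rcases n with _ | n
    · simp
    · push_cast
      have h1 : (n + 1 : ℝ) ≠ 0 := by positivity
      have h2 : (n + 1 + 1 : ℝ) ≠ 0 := by positivity
      rw [show (n : ℝ) + 1 + 1 - 1 = n + 1 by ring]
      field_simp
  have hUF := one_sub_C_mul_mul_eq_one hF0 t hU
  have hdF : (1 - X) * d⁄dX ℝ F = 1 - C t * F := by
    ext k
    rw [sub_mul, one_mul, map_sub, map_sub, coeff_C_mul, coeff_derivative]
    rcases k with _ | k
    · simp [hFdef, binomCoeff]
    · rw [coeff_succ_X_mul, coeff_derivative]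
      have := eval_binomCoeff_add_two k t
      simp only [hFdef, coeff_mk, coeff_one]
      push_cast
      simp
      linarith
  have hdD : (1 - X) * d⁄dX ℝ D = F - C t * D := by
    ext k
    rw [sub_mul, one_mul, map_sub, map_sub, coeff_C_mul, coeff_derivative]
    rcases k with _ | k
    · simp [hDdef, hFdef, binomCoeff]
    · rw [coeff_succ_X_mul, coeff_derivative]
      have := eval_derivative_binomCoeff_add_two k t
      simp only [hDdef, hFdef, coeff_mk]
      push_cast
      linarith
  have hdV1 : (1 - X) * d⁄dX ℝ V = 1 := by
    linear_combination (1 - X) * hdV + U * hdF + hUF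
  have hC : d⁄dX ℝ (C t : ℝ⟦X⟧) = 0 := derivative_C
  have h1 : F - C t * D - (1 - C t * F) * V = 0 := by
    refine PowerSeries.eq_zero_of_one_sub_X_mul_derivative t (by simp [hF0, hD0, hV0]) ?_
    simp only [map_sub, Derivation.leibniz, smul_eq_mul, hC, Derivation.map_one_eq_zero, mul_zero,
      add_zero]
    linear_combination (1 + C t * V) * hdF - C t * hdD - (1 - C t * F) * hdV1
  have h2 : d⁄dX ℝ W = d⁄dX ℝ D := by
    have hX : (1 - X : ℝ⟦X⟧) ≠ 0 := fun h => by
      have := congrArg constantCoeff h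
      simp at this
    refine mul_left_cancel₀ hX ?_
    linear_combination (1 - X) * hdW + V * hdF - hdD - h1
  have h3 : W = D := derivative.ext h2 (by rw [hW0, hD0])
  have h4 := congrArg (coeff k) h3
  rw [hW k k le_rfl, coeff_mk, map_sum] at h4
  rw [← h4]
  refine Finset.sum_subset_zero_on_sdiff (fun n hn => ?_) (fun n hn => ?_) (fun n hn => ?_)
  · simp only [Finset.mem_Icc, Finset.mem_range] at hn ⊢; omega
  · simp only [Finset.mem_Icc, Finset.mem_range, Finset.mem_sdiff] at hn
    have : n = 0 ∨ n = 1 := by omega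
    rcases this with rfl | rfl <;> simp
  · rw [Finset.mem_Icc] at hn
    obtain ⟨n, rfl⟩ : ∃ m, n = m + 1 := ⟨n - 1, by omega⟩
    rw [Lam_eq_coeff (by simp [binomCoeff]), map_smul, smul_eq_mul]

end GeneratingSeries

theorem intervalIntegral_derivative_eval (p : Polynomial ℝ) (a b : ℝ) :
    ∫ u in a..b, p.derivative.eval u = p.eval b - p.eval a :=
  intervalIntegral.integral_eq_sub_of_hasDerivAt (fun u _ => p.hasDerivAt u)
    (p.derivative.continuous.intervalIntegrable _ _)

/-- The image under a continuous monotone function of its Lebesgue–Stieltjes measure is Lebesgue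
measure. -/
theorem map_restrict_Ioc_eq_volume {x : ℝ → ℝ} {q b : ℝ} (hqb : q ≤ b)
    (hmono : MonotoneOn x (Set.Icc q b)) (hcont : ContinuousOn x (Set.Icc q b)) {ν : Measure ℝ}
    (hν : ∀ c ∈ Set.Icc q b, ν (Set.Ioc q c) = ENNReal.ofReal (x c - x q)) :
    (ν.restrict (Set.Ioc q b)).map x = volume.restrict (Set.Ioc (x q) (x b)) := by
  have hq : q ∈ Set.Icc q b := ⟨le_rfl, hqb⟩
  have hb : b ∈ Set.Icc q b := ⟨hqb, le_rfl⟩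
  have hx : AEMeasurable x (ν.restrict (Set.Ioc q b)) :=
    (hcont.mono Set.Ioc_subset_Icc_self).aemeasurable measurableSet_Ioc
  have : IsFiniteMeasure (ν.restrict (Set.Ioc q b)) :=
    ⟨by rw [Measure.restrict_apply_univ, hν b hb]; exact ENNReal.ofReal_lt_top⟩
  refine Measure.ext_of_Iic _ _ fun a => ?_
  rw [Measure.map_apply_of_aemeasurable hx measurableSet_Iic,
    Measure.restrict_apply measurableSet_Iic, Measure.restrict_apply' measurableSet_Ioc,
    Set.inter_comm (Set.Iic a), Set.Ioc_inter_Iic, Real.volume_Ioc]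
  rcases lt_or_ge a (x q) with ha | ha
  · have hempty : x ⁻¹' Set.Iic a ∩ Set.Ioc q b = ∅ := by
      ext u
      simp only [Set.mem_inter_iff, Set.mem_preimage, Set.mem_Iic, Set.mem_empty_iff_false,
        iff_false, not_and]
      intro hu hu'
      exact absurd (hmono hq (Set.Ioc_subset_Icc_self hu') hu'.1.le) (by linarith)
    rw [hempty, measure_empty, ENNReal.ofReal_of_nonpos]
    linarith [min_le_right (x b) a]
  · have hcompact : IsCompact (Set.Icc q b ∩ x ⁻¹' Set.Iic a) :=
      isCompact_Icc.of_isClosed_subset (hcont.preimage_isClosed_of_isClosed isClosed_Icc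
        isClosed_Iic) Set.inter_subset_left
    obtain ⟨c, ⟨hc, hca⟩, hcmax⟩ := hcompact.exists_isGreatest ⟨q, hq, ha⟩
    have hset : x ⁻¹' Set.Iic a ∩ Set.Ioc q b = Set.Ioc q c := by
      ext u
      constructor
      · rintro ⟨hu, hu'⟩
        exact ⟨hu'.1, hcmax ⟨Set.Ioc_subset_Icc_self hu', hu⟩⟩
      · intro hu
        have hub : u ≤ b := hu.2.trans hc.2
        exact ⟨(hmono ⟨hu.1.le, hub⟩ hc hu.2).trans hca, hu.1, hub⟩
    have hxc : x c = min (x b) a := by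
      refine le_antisymm (le_min (hmono hc hb hc.2) hca) ?_
      obtain ⟨d, hd, hxd⟩ := intermediate_value_Icc hqb hcont
        (show min (x b) a ∈ Set.Icc (x q) (x b) from
          ⟨le_min (hmono hq hb hqb) ha, min_le_left _ _⟩)
      have hda : x d ≤ a := hxd ▸ min_le_right _ _
      exact hxd ▸ hmono hd hc (hcmax ⟨hd, hda⟩)
    rw [hset, hν c hc, hxc]

/-- **Bound on the series-expansion coefficient processes.**
If `|Z| ≤ 1 - ε` a.s. for some `0 < ε < 1`, then for every `k ≥ 1` and `q ∈ [0,1]`,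
`|Σ_k(Z; q)| ≤ (1-ε)^k / k` a.s., where the `Σ_k(Z; ·)` satisfy the recursion
`Σ_1(Z; q) = E[Z | F_q]` and, for `k ≥ 2`,
`Σ_k(Z; q) = E[∫_{(q,1]} Σ_{n=2}^{k} (x(q')^{n-2}/(n(n-1))) Λ_{k,n}(Σ(Z); q') dμ(q') | F_q]`,
`μ` being the Lebesgue–Stieltjes measure of the Parisi order parameter `x`. -/
theorem stmt3
    {Ω : Type*} {mΩ : MeasurableSpace Ω} (μ : Measure Ω) [IsProbabilityMeasure μ]
    (ℱ : Filtration ℝ mΩ)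
    (x : ℝ → ℝ)
    (hxmono : MonotoneOn x (Set.Icc (0 : ℝ) 1))
    (hxcont : ContinuousOn x (Set.Icc (0 : ℝ) 1))
    (hx0 : x 0 = 0) (hx1 : x 1 = 1)
    (ν : Measure ℝ)
    (hν : ∀ a b : ℝ, 0 ≤ a → a ≤ b → b ≤ 1 →
      ν (Set.Ioc a b) = ENNReal.ofReal (x b - x a))
    (Z : Ω → ℝ) (hZmeas : StronglyMeasurable[ℱ 1] Z)
    (ε : ℝ) (hε0 : 0 < ε) (hε1 : ε < 1)
    (hZbdd : ∀ᵐ ω ∂μ, |Z ω| ≤ 1 - ε)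
    (Sig : ℕ → ℝ → Ω → ℝ)
    (hSigjm : ∀ k, Measurable (fun p : ℝ × Ω => Sig k p.1 p.2))
    (hSigbdd : ∀ k, 1 ≤ k → ∀ q ∈ Set.Icc (0 : ℝ) 1, ∃ C : ℝ, ∀ᵐ ω ∂μ, |Sig k q ω| ≤ C)
    (hSigone : ∀ q ∈ Set.Icc (0 : ℝ) 1, Sig 1 q =ᵐ[μ] μ[Z | ℱ q])
    (hSigrec : ∀ k, 2 ≤ k → ∀ q ∈ Set.Icc (0 : ℝ) 1,
      Sig k q =ᵐ[μ] μ[(fun ω => ∫ q' in Set.Ioc q 1,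
        (∑ n ∈ Finset.Icc 2 k,
          x q' ^ (n - 2) / ((n : ℝ) * ((n : ℝ) - 1)) *
            Lam (fun j => Sig j q' ω) k n) ∂ν) | ℱ q]) :
    ∀ k : ℕ, 1 ≤ k → ∀ q ∈ Set.Icc (0 : ℝ) 1,
      ∀ᵐ ω ∂μ, |Sig k q ω| ≤ (1 - ε) ^ k / (k : ℝ) := by
  have hr : 0 ≤ 1 - ε := by linarith
  set r := 1 - ε
  have hxmem : ∀ q ∈ Set.Icc (0 : ℝ) 1, x q ∈ Set.Icc (0 : ℝ) 1 := fun q hq =>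
    ⟨hx0 ▸ hxmono ⟨le_rfl, zero_le_one⟩ hq hq.1, hx1 ▸ hxmono hq ⟨zero_le_one, le_rfl⟩ hq.2⟩
  suffices hmain : ∀ k : ℕ, 1 ≤ k → ∀ q ∈ Set.Icc (0 : ℝ) 1,
      ∀ᵐ ω ∂μ, |Sig k q ω| ≤ r ^ k * (binomCoeff k).eval (x q) by
    intro k hk q hq
    filter_upwards [hmain k hk q hq] with ω hω
    refine hω.trans ?_
    obtain ⟨k, rfl⟩ : ∃ m, k = m + 1 := ⟨k - 1, by omega⟩
    rw [div_eq_mul_one_div]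
    push_cast
    exact mul_le_mul_of_nonneg_left (eval_binomCoeff_mem_Icc k (hxmem q hq)).2 (by positivity)
  intro k
  induction k using Nat.strong_induction_on with
  | _ k ih =>
  intro hk q hq
  rcases hk.eq_or_lt with rfl | hk2
  · filter_upwards [hSigone q hq, ae_bdd_abs_condExp_of_ae_bdd_abs (m := ℱ q) hZbdd] with ω h1 h2
    simpa [h1, binomCoeff] using h2
  have hk2 : 2 ≤ k := hk2
  set y : ℝ → ℝ := Set.IccExtend zero_le_one ((Set.Icc (0 : ℝ) 1).domRestrict x) with hy
  have hycont : Continuous y := (continuousOn_iff_continuous_domRestrict.1 hxcont).Icc_extend'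
  have hyx : ∀ q ∈ Set.Icc (0 : ℝ) 1, y q = x q := fun q hq => by
    rw [hy, Set.IccExtend_of_mem _ _ hq, Set.domRestrict_apply]
  set ν' := ν.restrict (Set.Ioc q 1) with hν'
  have hfin : IsFiniteMeasure ν' :=
    ⟨by rw [hν', Measure.restrict_apply_univ, hν q 1 hq.1 hq.2 le_rfl]
        exact ENNReal.ofReal_lt_top⟩
  have hmem : ∀ᵐ u ∂ν', u ∈ Set.Icc (0 : ℝ) 1 := by
    filter_upwards [ae_restrict_mem measurableSet_Ioc] with u hu
    exact ⟨hq.1.trans hu.1.le, hu.2⟩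
  have hswap : ∀ᵐ ω ∂μ, ∀ᵐ u ∂ν', ∀ j, 1 ≤ j → j < k →
      |Sig j u ω| ≤ r ^ j * (binomCoeff j).eval (y u) := by
    simp only [ae_all_iff]
    intro j hj1 hjk
    have hmeas : MeasurableSet {p : ℝ × Ω |
        |Sig j p.1 p.2| ≤ r ^ j * (binomCoeff j).eval (y p.1)} := by
      refine measurableSet_le (hSigjm j).abs ?_
      have : Measurable fun u => r ^ j * (binomCoeff j).eval (y u) :=
        (continuous_const.mul ((binomCoeff j).continuous.comp hycont)).measurable
      exact this.comp measurable_fst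
    refine (Measure.ae_ae_comm hmeas).1 ?_
    filter_upwards [hmem] with u hu
    rw [hyx u hu]
    exact ih j hjk hj1 u hu
  have hmap := map_restrict_Ioc_eq_volume (ν := ν) hq.2
    (hxmono.mono (Set.Icc_subset_Icc_left hq.1)) (hxcont.mono (Set.Icc_subset_Icc_left hq.1))
    fun c hc => hν q c hq.1 hc.1 hc.2
  have hxmeas : AEMeasurable x ν' := (hxcont.mono fun u hu =>
    ⟨hq.1.trans hu.1.le, hu.2⟩).aemeasurable measurableSet_Ioc
  set g : ℝ → ℝ := fun t => r ^ k * -(binomCoeff k).derivative.eval t with hg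
  have hgcont : Continuous g := by fun_prop
  have hgint : Integrable (fun u => g (x u)) ν' := by
    rw [← Function.comp_def, ← integrable_map_measure hgcont.aestronglyMeasurable hxmeas, hmap]
    exact (hgcont.integrableOn_Icc).mono_set Set.Ioc_subset_Icc_self
  have hgval : ∫ u, g (x u) ∂ν' = r ^ k * (binomCoeff k).eval (x q) := by
    rw [← integral_map hxmeas hgcont.aestronglyMeasurable, hmap, hx1,
      ← intervalIntegral.integral_of_le (hxmem q hq).2, hg, intervalIntegral.integral_const_mul,
      intervalIntegral.integral_neg, intervalIntegral_derivative_eval]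
    obtain ⟨k, rfl⟩ : ∃ m, k = m + 2 := ⟨k - 2, by omega⟩
    rw [eval_one_binomCoeff_add_two, zero_sub, neg_neg]
  have hbound : ∀ᵐ ω ∂μ, |∫ u, (∑ n ∈ Finset.Icc 2 k, x u ^ (n - 2) / ((n : ℝ) * ((n : ℝ) - 1)) *
      Lam (fun j => Sig j u ω) k n) ∂ν'| ≤ r ^ k * (binomCoeff k).eval (x q) := by
    filter_upwards [hswap] with ω hω
    rw [← hgval, ← Real.norm_eq_abs]
    refine norm_integral_le_of_norm_le hgint ?_
    filter_upwards [hω, hmem] with u hu hmu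
    rw [hyx u hmu] at hu
    rw [Real.norm_eq_abs]
    simp only [hg]
    rw [← sum_Lam_binomCoeff, Finset.mul_sum]
    refine (Finset.abs_sum_le_sum_abs _ _).trans (Finset.sum_le_sum fun n hn => ?_)
    have hn2 := (Finset.mem_Icc.1 hn).1
    obtain ⟨n, rfl⟩ : ∃ m, n = m + 1 := ⟨n - 1, by omega⟩
    have hcoef : 0 ≤ x u ^ (n + 1 - 2) / (((n + 1 : ℕ) : ℝ) * (((n + 1 : ℕ) : ℝ) - 1)) := by
      have := (hxmem u hmu).1
      push_cast
      rw [add_sub_cancel_right]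
      positivity
    rw [abs_mul, abs_of_nonneg hcoef, mul_left_comm, ← Lam_geometric_mul (by simp [binomCoeff])]
    refine mul_le_mul_of_nonneg_left ?_ hcoef
    exact abs_Lam_le n k hk fun j hj hjn => hu j hj (by omega)
  filter_upwards [hSigrec k hk2 q hq, ae_bdd_abs_condExp_of_ae_bdd_abs (m := ℱ q) hbound] with ω h1 h2
  rw [h1]
  exact h2
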